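/- Let X be a nonempty w-invex subset of ℝⁿ with respect to η and w, and let h : X → ℝ. Then h is w-quasi preinvex with respect to η and w if and only if for every α ∈ ℝ the level set M_α = {z ∈ X : h(z) ≤ α} is w-invex with respect to the same η and w. -/

import Mathlib

/-- h is w-quasi preinvex iff every level set is w-invex. -/
theorem w_quasi_preinvex_iff_levelSets_w_invex {n : ℕ}
    (X : Set (Fin n → ℝ)) (hX : X.Nonempty)
    (η : (Fin n → ℝ) → (Fin n → ℝ) → (Fin n → ℝ)) (w : (Fin n → ℝ) → (Fin n → ℝ))
    (hXinvex : ∀ z₁ ∈ X, ∀ z₂ ∈ X, ∀ δ ∈ Set.Icc (0:ℝ) 1,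
      w z₂ + δ • η z₁ (w z₂) ∈ X)
    (h : (Fin n → ℝ) → ℝ) :
    (∀ z₁ ∈ X, ∀ z₂ ∈ X, ∀ δ ∈ Set.Icc (0:ℝ) 1,
        h (w z₂ + δ • η z₁ (w z₂)) ≤ max (h z₁) (h z₂)) ↔
    (∀ α : ℝ, ∀ z₁ ∈ {z ∈ X | h z ≤ α}, ∀ z₂ ∈ {z ∈ X | h z ≤ α},
        ∀ δ ∈ Set.Icc (0:ℝ) 1, w z₂ + δ • η z₁ (w z₂) ∈ {z ∈ X | h z ≤ α}) := by
  constructor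
  · intro H α z₁ h₁ z₂ h₂ δ hδ
    exact ⟨hXinvex z₁ h₁.1 z₂ h₂.1 δ hδ,
      (H z₁ h₁.1 z₂ h₂.1 δ hδ).trans (max_le h₁.2 h₂.2)⟩
  · intro H z₁ h₁ z₂ h₂ δ hδ
    exact (H (max (h z₁) (h z₂)) z₁ ⟨h₁, le_max_left _ _⟩ z₂ ⟨h₂, le_max_right _ _⟩ δ hδ).2
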